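/- For all n ≥ 0, A_{B_n} ∈ {A_n + B_n − 1, A_n + B_n}. -/

import Mathlib

/-- The substitution `h` with `h(1) = 110` and `h(0) = 11`. -/
def hsub : ℕ → List ℕ
  | 0 => [1, 1]
  | 1 => [1, 1, 0]
  | _ => []

/-- `h` extended to words by concatenation. -/
def happ (w : List ℕ) : List ℕ := w.flatMap hsub

/-- `K n = h^n(1)`. -/
def Kword (n : ℕ) : List ℕ := happ^[n] [1]

lemma happ_append (u v : List ℕ) : happ (u ++ v) = happ u ++ happ v := by
  simp [happ]

lemma happ_length (w : List ℕ) (hw : ∀ x ∈ w, x = 0 ∨ x = 1) :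
    (happ w).length = 2 * w.length + w.sum := by
  induction w with
  | nil => simp [happ]
  | cons x t ih =>
    have ht := ih (fun y hy => hw y (List.mem_cons_of_mem _ hy))
    have e : happ (x :: t) = hsub x ++ happ t := by simp [happ]
    rw [e, List.length_append, ht]
    rcases hw x List.mem_cons_self with rfl | rfl
    · simp [hsub]; omega
    · simp [hsub]; omega

lemma happ_bin (w : List ℕ) : ∀ x ∈ happ w, x = 0 ∨ x = 1 := by
  intro x hx
  simp only [happ, List.mem_flatMap] at hx
  obtain ⟨a, -, ha⟩ := hx
  match a, ha with
  | 0, ha => simp [hsub] at ha; omega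
  | 1, ha => simp [hsub] at ha; omega
  | (n+2), ha => simp [hsub] at ha

lemma Kword_succ (n : ℕ) : Kword (n + 1) = happ (Kword n) := by
  simp only [Kword, Function.iterate_succ_apply']

lemma Kword_bin (n : ℕ) : ∀ x ∈ Kword n, x = 0 ∨ x = 1 := by
  cases n with
  | zero => simp [Kword]
  | succ n => rw [Kword_succ]; exact happ_bin _

lemma Kword_len (n : ℕ) : n < (Kword n).length := by
  induction n with
  | zero => simp [Kword]
  | succ n ih => rw [Kword_succ, happ_length _ (Kword_bin n)]; omega

/-- number of ones among the first `m` letters -/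
def onesUpTo (k : ℕ → ℕ) : ℕ → ℕ
  | 0 => 0
  | m + 1 => onesUpTo k m + k (m + 1)

lemma k_bin {k : ℕ → ℕ}
    (hk : ∀ (m i : ℕ), i < (Kword m).length → k (i + 1) = (Kword m).getD i 0)
    (i : ℕ) : k (i + 1) = 0 ∨ k (i + 1) = 1 := by
  have h := Kword_len i
  rw [hk i i h, List.getD_eq_getElem _ _ h]
  exact Kword_bin i _ (List.getElem_mem h)

lemma take_sum {k : ℕ → ℕ}
    (hk : ∀ (m i : ℕ), i < (Kword m).length → k (i + 1) = (Kword m).getD i 0)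
    (n i : ℕ) (hi : i ≤ (Kword n).length) :
    ((Kword n).take i).sum = onesUpTo k i := by
  induction i with
  | zero => simp [onesUpTo]
  | succ i ih =>
    have h : i < (Kword n).length := hi
    rw [List.take_add_one, List.sum_append, ih (by omega), onesUpTo, hk n i h]
    simp [h]

lemma k_block {k : ℕ → ℕ}
    (hk : ∀ (m i : ℕ), i < (Kword m).length → k (i + 1) = (Kword m).getD i 0)
    (m r : ℕ) (hr : r < (hsub (k (m + 1))).length) :
    k (2 * m + onesUpTo k m + r + 1) = (hsub (k (m + 1))).getD r 0 := by
  have h := Kword_len m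
  have e : Kword m = (Kword m).take m ++ ([k (m + 1)] ++ (Kword m).drop (m + 1)) := by
    rw [hk m m h, List.getD_eq_getElem _ _ h]
    simp
  have e2 : Kword (m + 1) = happ ((Kword m).take m) ++ (hsub (k (m + 1)) ++
      happ ((Kword m).drop (m + 1))) := by
    rw [Kword_succ]
    conv_lhs => rw [e]
    rw [happ_append, happ_append]
    simp [happ]
  have el : (happ ((Kword m).take m)).length = 2 * m + onesUpTo k m := by
    rw [happ_length _ (fun x hx => Kword_bin m x (List.mem_of_mem_take hx)),
      take_sum hk m m h.le, List.length_take, min_eq_left h.le]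
  rw [hk (m + 1) _ (by rw [e2]; simp only [List.length_append]; omega), e2,
    List.getD_append_right _ _ _ _ (by omega), List.getD_append _ _ _ _ (by omega), el]
  congr 1; omega

lemma k_one {k : ℕ → ℕ}
    (hk : ∀ (m i : ℕ), i < (Kword m).length → k (i + 1) = (Kword m).getD i 0)
    (m : ℕ) : k (2 * m + onesUpTo k m + 1) = 1 := by
  have := k_block hk m 0
  rcases k_bin hk m with h | h <;> rw [h] at this <;> simpa [hsub] using this

lemma k_two {k : ℕ → ℕ}
    (hk : ∀ (m i : ℕ), i < (Kword m).length → k (i + 1) = (Kword m).getD i 0)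
    (m : ℕ) : k (2 * m + onesUpTo k m + 2) = 1 := by
  have := k_block hk m 1
  rcases k_bin hk m with h | h <;> rw [h] at this <;> simpa [hsub] using this

lemma k_three {k : ℕ → ℕ}
    (hk : ∀ (m i : ℕ), i < (Kword m).length → k (i + 1) = (Kword m).getD i 0)
    (m : ℕ) (h : k (m + 1) = 1) : k (2 * m + onesUpTo k m + 3) = 0 := by
  have := k_block hk m 2
  rw [h] at this; simpa [hsub] using this

lemma ones_block {k : ℕ → ℕ}
    (hk : ∀ (m i : ℕ), i < (Kword m).length → k (i + 1) = (Kword m).getD i 0)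
    (m : ℕ) : onesUpTo k (2 * m + onesUpTo k m) = 2 * m := by
  induction m with
  | zero => simp [onesUpTo]
  | succ m ih =>
    have h1 := k_one hk m
    have h2 := k_two hk m
    rcases k_bin hk m with h | h
    · have : 2 * (m + 1) + onesUpTo k (m + 1) = 2 * m + onesUpTo k m + 1 + 1 := by
        simp only [onesUpTo, h]; omega
      rw [this]; simp only [onesUpTo, ih, h1, h2]; omega
    · have h3 := k_three hk m h
      have : 2 * (m + 1) + onesUpTo k (m + 1) = 2 * m + onesUpTo k m + 1 + 1 + 1 := by
        simp only [onesUpTo, h]; omega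
      rw [this]; simp only [onesUpTo, ih, h1, h2, h3]; omega

lemma ones_block1 {k : ℕ → ℕ}
    (hk : ∀ (m i : ℕ), i < (Kword m).length → k (i + 1) = (Kword m).getD i 0)
    (m : ℕ) : onesUpTo k (2 * m + onesUpTo k m + 1) = 2 * m + 1 := by
  rw [onesUpTo, ones_block hk, k_one hk]

lemma ones_block2 {k : ℕ → ℕ}
    (hk : ∀ (m i : ℕ), i < (Kword m).length → k (i + 1) = (Kword m).getD i 0)
    (m : ℕ) : onesUpTo k (2 * m + onesUpTo k m + 2) = 2 * m + 2 := by
  rw [onesUpTo, ones_block1 hk, k_two hk]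

lemma block_form {k : ℕ → ℕ}
    (hk : ∀ (m i : ℕ), i < (Kword m).length → k (i + 1) = (Kword m).getD i 0)
    (p : ℕ) : ∃ m r, r ≤ 2 ∧ p = 2 * m + onesUpTo k m + r ∧
    onesUpTo k p = 2 * m + r := by
  have key : ∃ m r, r ≤ 2 ∧ p = 2 * m + onesUpTo k m + r := by
    induction p with
    | zero => exact ⟨0, 0, by simp [onesUpTo]⟩
    | succ p ih =>
      obtain ⟨m, r, hr, rfl⟩ := ih
      by_cases h2 : r = 2
      · rcases k_bin hk m with h | h
        · exact ⟨m + 1, 1, by omega, by simp only [onesUpTo, h]; omega⟩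
        · exact ⟨m + 1, 0, by omega, by simp only [onesUpTo, h]; omega⟩
      · exact ⟨m, r + 1, by omega, by omega⟩
  obtain ⟨m, r, hr, e⟩ := key
  refine ⟨m, r, hr, e, ?_⟩
  rw [e]
  interval_cases r
  · exact ones_block hk m
  · exact ones_block1 hk m
  · exact ones_block2 hk m

lemma ones_lip {k : ℕ → ℕ}
    (hk : ∀ (m i : ℕ), i < (Kword m).length → k (i + 1) = (Kword m).getD i 0)
    {a b : ℕ} (h : a ≤ b) :
    onesUpTo k a ≤ onesUpTo k b ∧ onesUpTo k b + a ≤ onesUpTo k a + b := by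
  induction b, h using Nat.le_induction with
  | base => omega
  | succ b _ ih =>
    have := k_bin hk b
    simp only [onesUpTo]; omega

/-- Key estimate. -/
lemma F_bound {k : ℕ → ℕ}
    (hk : ∀ (m i : ℕ), i < (Kword m).length → k (i + 1) = (Kword m).getD i 0)
    (p : ℕ) : 2 * onesUpTo k p ≤ onesUpTo k (2 * p + 1) + 1 ∧
    onesUpTo k (2 * p + 1) ≤ 2 * onesUpTo k p + 2 := by
  induction p using Nat.strong_induction_on with
  | _ p ih =>
    rcases Nat.eq_zero_or_pos p with rfl | hp
    · have := k_bin hk 0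
      simp only [onesUpTo]; omega
    obtain ⟨m, r, hr, e, o⟩ := block_form hk p
    obtain ⟨m', r', hr', e', o'⟩ := block_form hk (2 * p + 1)
    have hm : m < p := by omega
    have := ih m hm
    rcases le_total m' (2 * m + 1) with h | h
    · have := ones_lip hk h
      omega
    · have := ones_lip hk h
      omega

lemma ones_le {k : ℕ → ℕ}
    (hk : ∀ (m i : ℕ), i < (Kword m).length → k (i + 1) = (Kword m).getD i 0)
    (a : ℕ) : onesUpTo k a ≤ a := by
  have := ones_lip hk (Nat.zero_le a)
  simp only [onesUpTo] at this; omega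

lemma count_one {k : ℕ → ℕ}
    (hk : ∀ (m i : ℕ), i < (Kword m).length → k (i + 1) = (Kword m).getD i 0)
    (m : ℕ) [DecidablePred (fun i => 1 ≤ i ∧ k i = 1)] :
    Nat.count (fun i => 1 ≤ i ∧ k i = 1) (m + 1) = onesUpTo k m := by
  induction m with
  | zero => simp [Nat.count_succ, onesUpTo]
  | succ m ih =>
    rw [Nat.count_succ, ih, onesUpTo]
    rcases k_bin hk m with h | h <;> simp [h]

lemma count_zero {k : ℕ → ℕ}
    (hk : ∀ (m i : ℕ), i < (Kword m).length → k (i + 1) = (Kword m).getD i 0)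
    (m : ℕ) [DecidablePred (fun i => 1 ≤ i ∧ k i = 0)] :
    Nat.count (fun i => 1 ≤ i ∧ k i = 0) (m + 1) + onesUpTo k m = m := by
  induction m with
  | zero => simp [Nat.count_succ, onesUpTo]
  | succ m ih =>
    rw [Nat.count_succ, onesUpTo]
    rcases k_bin hk m with h | h <;> simp [h] <;> omega

lemma nth_one {k : ℕ → ℕ}
    (hk : ∀ (m i : ℕ), i < (Kword m).length → k (i + 1) = (Kword m).getD i 0)
    (n m : ℕ) (h1 : k (m + 1) = 1) (h2 : onesUpTo k m = n) :
    Nat.nth (fun i => 1 ≤ i ∧ k i = 1) n = m + 1 := by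
  classical
  rw [← h2, ← count_one hk m]
  exact Nat.nth_count (p := fun i => 1 ≤ i ∧ k i = 1) ⟨by omega, h1⟩

lemma nth_zero {k : ℕ → ℕ}
    (hk : ∀ (m i : ℕ), i < (Kword m).length → k (i + 1) = (Kword m).getD i 0)
    (n m : ℕ) (h1 : k (m + 1) = 0) (h2 : onesUpTo k m + n = m) :
    Nat.nth (fun i => 1 ≤ i ∧ k i = 0) n = m + 1 := by
  classical
  have h3 : n = Nat.count (fun i => 1 ≤ i ∧ k i = 0) (m + 1) := by
    have := count_zero hk m; omega
  rw [h3]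
  exact Nat.nth_count (p := fun i => 1 ≤ i ∧ k i = 0) ⟨by omega, h1⟩

/-- position of the `(n+1)`-th one -/
lemma pos_one {k : ℕ → ℕ}
    (hk : ∀ (m i : ℕ), i < (Kword m).length → k (i + 1) = (Kword m).getD i 0)
    (n : ℕ) : k (n + onesUpTo k (n / 2) + 1) = 1 ∧
    onesUpTo k (n + onesUpTo k (n / 2)) = n := by
  rcases Nat.even_or_odd' n with ⟨j, rfl | rfl⟩
  · have e : 2 * j / 2 = j := by omega
    rw [e]
    exact ⟨k_one hk j, ones_block hk j⟩
  · have e : (2 * j + 1) / 2 = j := by omega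
    have e2 : 2 * j + 1 + onesUpTo k j = 2 * j + onesUpTo k j + 1 := by omega
    rw [e, e2]
    exact ⟨k_two hk j, ones_block1 hk j⟩

/-- position of the `(n+1)`-th zero -/
lemma pos_zero {k : ℕ → ℕ}
    (hk : ∀ (m i : ℕ), i < (Kword m).length → k (i + 1) = (Kword m).getD i 0)
    (n : ℕ) : k (3 * n + 2 * onesUpTo k (n / 2) + 2 + 1) = 0 ∧
    onesUpTo k (3 * n + 2 * onesUpTo k (n / 2) + 2) + n
      = 3 * n + 2 * onesUpTo k (n / 2) + 2 := by
  obtain ⟨h1, h2⟩ := pos_one hk n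
  have h3 := k_three hk _ h1
  have h4 := ones_block2 hk (n + onesUpTo k (n / 2))
  rw [h2] at h3 h4
  have e : 2 * (n + onesUpTo k (n / 2)) + n + 2 = 3 * n + 2 * onesUpTo k (n / 2) + 2 := by
    omega
  rw [e] at h4
  have e' : 2 * (n + onesUpTo k (n / 2)) + n + 3 = 3 * n + 2 * onesUpTo k (n / 2) + 2 + 1 := by
    omega
  rw [e'] at h3
  exact ⟨h3, by omega⟩

theorem A_of_B
    (k : ℕ → ℕ)
    (hk : ∀ (m i : ℕ), i < (Kword m).length → k (i + 1) = (Kword m).getD i 0)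
    (A B : ℕ → ℕ)
    (hA0 : A 0 = 0) (hB0 : B 0 = 0)
    (hA : ∀ n : ℕ, 1 ≤ n → A n = Nat.nth (fun i => 1 ≤ i ∧ k i = 1) (n - 1))
    (hB : ∀ n : ℕ, 1 ≤ n → B n = Nat.nth (fun i => 1 ≤ i ∧ k i = 0) (n - 1)) :
    ∀ n : ℕ, (A (B n) : ℤ) ∈ ({(A n : ℤ) + (B n : ℤ) - 1, (A n : ℤ) + (B n : ℤ)} : Set ℤ) := by
  have hA' : ∀ n, A (n + 1) = n + onesUpTo k (n / 2) + 1 := fun n => by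
    rw [hA _ (by omega)]
    exact nth_one hk _ _ (pos_one hk n).1 (pos_one hk n).2
  have hB' : ∀ n, B (n + 1) = 3 * n + 2 * onesUpTo k (n / 2) + 2 + 1 := fun n => by
    rw [hB _ (by omega)]
    exact nth_zero hk _ _ (pos_zero hk n).1 (pos_zero hk n).2
  intro n
  rcases n with _ | n
  · simp [hA0, hB0]
  obtain ⟨j, hj⟩ : ∃ j, j = n / 2 := ⟨_, rfl⟩
  have ha := hA' n
  have hb := hB' n
  rw [← hj] at ha hb
  have hab := hA' (3 * n + 2 * onesUpTo k j + 2)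
  rw [← hb] at hab
  have e : (3 * n + 2 * onesUpTo k j + 2) / 2 = n + onesUpTo k j + 1 + j := by omega
  rw [e] at hab
  have up : onesUpTo k (n + onesUpTo k j + 1 + j) ≤ n + onesUpTo k j + 1 := by
    rcases Nat.eq_zero_or_pos j with h0 | h0
    · have := ones_le hk (n + onesUpTo k j + 1 + j)
      omega
    · obtain ⟨i, hi⟩ : ∃ i, i = (j - 1) / 2 := ⟨_, rfl⟩
      have hz := pos_zero hk (j - 1)
      rw [← hi] at hz
      have hs : onesUpTo k (3 * (j - 1) + 2 * onesUpTo k i + 2 + 1) =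
        onesUpTo k (3 * (j - 1) + 2 * onesUpTo k i + 2) + 0 := by
        rw [onesUpTo, hz.1]
      have hF := F_bound hk i
      have hmono := (ones_lip hk (show 2 * i + 1 ≤ j by omega)).1
      have hl := (ones_lip hk (show 3 * (j - 1) + 2 * onesUpTo k i + 2 + 1 ≤
        n + onesUpTo k j + 1 + j by omega)).2
      omega
  have lo : n + onesUpTo k j ≤ onesUpTo k (n + onesUpTo k j + 1 + j) := by
    obtain ⟨i, hi⟩ : ∃ i, i = (j + 1) / 2 := ⟨_, rfl⟩
    have hz := pos_zero hk (j + 1)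
    rw [← hi] at hz
    have hF := F_bound hk i
    have hmono := (ones_lip hk (show j ≤ 2 * i + 1 by omega)).1
    have hl := (ones_lip hk (show n + onesUpTo k j + 1 + j ≤
      3 * (j + 1) + 2 * onesUpTo k i + 2 by omega)).2
    omega
  simp only [Set.mem_insert_iff, Set.mem_singleton_iff]
  have h : A (B (n + 1)) + 1 = A (n + 1) + B (n + 1) ∨
      A (B (n + 1)) = A (n + 1) + B (n + 1) := by omega
  rcases h with h | h
  · left; zify at h; linarith
  · right; exact_mod_cast h
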